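/- Let A be a ring with a ℤ/2-grading 𝒜 : ZMod 2 → AddSubgroup A making it a graded ring, let I be a two-sided ideal of A, and let π : A → A⧸I be the quotient ring homomorphism. Then I is ℤ/2-graded — i.e. for every a ∈ I both homogeneous components (DirectSum.decompose 𝒜 a) 0 and (DirectSum.decompose 𝒜 a) 1 (viewed in A) lie in I — if and only if the images of the even and odd parts intersect trivially in the quotient, i.e. (𝒜 0).map π ⊓ (𝒜 1).map π = ⊥ as additive subgroups of A⧸I. (This trivial intersection is exactly the condition that A⧸I inherits a ℤ/2-grading from A with π grading-preserving, i.e. that I is supernormal.) -/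

import Mathlib

theorem TwoSidedIdeal.ringCon_mk'_eq_zero_iff {A : Type*} [Ring A] (I : TwoSidedIdeal A) (a : A) :
    RingCon.mk' I.ringCon a = 0 ↔ a ∈ I := by
  rw [TwoSidedIdeal.mem_iff]
  exact RingCon.eq I.ringCon

theorem decompose_zero_add_decompose_one {A : Type*} [AddCommGroup A]
    (𝒜 : ZMod 2 → AddSubgroup A) [DirectSum.Decomposition 𝒜] (a : A) :
    (DirectSum.decompose 𝒜 a 0 : A) + (DirectSum.decompose 𝒜 a 1 : A) = a := by
  classical
  have h : ∑ i : ZMod 2, (DirectSum.decompose 𝒜 a i : A) = a := by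
    conv_rhs => rw [← DirectSum.sum_support_decompose 𝒜 a]
    refine (Finset.sum_subset (Finset.subset_univ _) fun i _ hi => ?_).symm
    simpa using hi
  rwa [show (Finset.univ : Finset (ZMod 2)) = {0, 1} from rfl,
    Finset.sum_pair (by decide)] at h

/-- **ℤ/2-graded ideal = supernormal ideal** (Definition/Lemma 2.1.2).
A two-sided ideal `I` of a ℤ/2-graded ring `A` is ℤ/2-graded (both homogeneous
components of any element of `I` again lie in `I`) if and only if the images of
the even and odd parts of `A` in the quotient ring `A⧸I` intersect trivially,
i.e. `I` is supernormal. -/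
theorem graded_ideal_iff_supernormal {A : Type*} [Ring A]
    (𝒜 : ZMod 2 → AddSubgroup A) [GradedRing 𝒜]
    (I : TwoSidedIdeal A) (π : A →+* I.ringCon.Quotient) (hπ : π = RingCon.mk' I.ringCon) :
    (∀ a ∈ I, ((DirectSum.decompose 𝒜 a 0 : A) ∈ I ∧ (DirectSum.decompose 𝒜 a 1 : A) ∈ I))
      ↔ (𝒜 0).map π.toAddMonoidHom ⊓ (𝒜 1).map π.toAddMonoidHom = ⊥ := by
  subst hπ
  have hker := I.ringCon_mk'_eq_zero_iff
  constructor
  · intro h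
    rw [eq_bot_iff]
    rintro y ⟨⟨a, ha, rfl⟩, ⟨b, hb, hab⟩⟩
    replace hab : RingCon.mk' I.ringCon b = RingCon.mk' I.ringCon a := hab
    have hmem : a - b ∈ I := by
      rw [← hker, map_sub, hab, sub_self]
    have h0 := (h _ hmem).1
    have hcomp : (DirectSum.decompose 𝒜 (a - b) 0 : A) = a := by
      rw [DirectSum.decompose_sub, DirectSum.sub_apply, AddSubgroup.coe_sub,
        DirectSum.decompose_of_mem_same 𝒜 ha,
        DirectSum.decompose_of_mem_ne 𝒜 hb (by decide : (1 : ZMod 2) ≠ 0), sub_zero]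
    rw [hcomp] at h0
    exact (hker a).2 h0
  · intro h a ha
    have hsum := decompose_zero_add_decompose_one 𝒜 a
    have h0 : (DirectSum.decompose 𝒜 a 0 : A) ∈ I := by
      rw [← hker, ← AddSubgroup.mem_bot, ← h]
      refine ⟨⟨_, (DirectSum.decompose 𝒜 a 0).2, rfl⟩,
        ⟨_, neg_mem (DirectSum.decompose 𝒜 a 1).2, ?_⟩⟩
      change RingCon.mk' I.ringCon _ = RingCon.mk' I.ringCon _
      rw [map_neg, neg_eq_iff_add_eq_zero, ← map_add, add_comm, hsum]
      exact (hker a).2 ha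
    refine ⟨h0, ?_⟩
    rw [← eq_sub_iff_add_eq'] at hsum
    rw [hsum]
    exact I.sub_mem ha h0
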